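/- arXiv:0910.3173 — 2 statements merged into one kernel-verified Lean document; each statement's English description precedes it below -/
import Mathlib

section
/- (Yang–Baxter algebra relation.) Let R(λ) be the 4×4 complex matrix acting on ℂ²⊗ℂ² whose only nonzero entries are R^{11}_{11} = R^{22}_{22} = qλ − q^{−1}λ^{−1}, R^{12}_{12} = R^{21}_{21} = λ − λ^{−1}, and R^{12}_{21} = R^{21}_{12} = q − q^{−1}. Then for all λ, μ ∈ ℂ∖{0}, the monodromy matrix satisfies R(λ/μ)·(M(λ)⊗I)·(I⊗M(μ)) = (I⊗M(μ))·(M(λ)⊗I)·R(λ/μ), an identity of 4×4 matrices whose entries are operators on H (the entries of R being understood as scalar multiples of the identity operator, and ⊗ the Kronecker product in the two-dimensional auxiliary spaces). -/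
open scoped BigOperators Matrix

noncomputable section

namespace SG

/-- Index set for the Hilbert space `H`: tuples in `(S_p)^N`, with a `p`-th root of
unity `z = q^m` encoded by its exponent `m : ZMod p`, `p = 2*l+1`. -/
abbrev Idx (l N : ℕ) := Fin N → ZMod (2*l+1)

/-- `q` raised to the power of an element of `ZMod (2*l+1)`. -/
def Qp (l : ℕ) (q : ℂ) (j : ZMod (2*l+1)) : ℂ := q ^ j.val

/-- The value `w_lam(q^(2n))` given by the defining product formula. -/
def wAux (l : ℕ) (q lam : ℂ) (n : ℕ) : ℂ :=
  (∏ r ∈ Finset.range n, (1 + lam * q ^ (2*r+1)) / (lam + q ^ (2*r+1))) *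
    ∏ r ∈ Finset.range l, (lam + q ^ (2*r+1)) / (1 + q ^ (2*r+1))

/-- `w lam m` is the value `w_lam(q^m)`; since `p` is odd, `q^m = q^(2n)` with
`n = (l+1)*m mod p`. -/
def w (l : ℕ) (q lam : ℂ) (m : ZMod (2*l+1)) : ℂ :=
  wAux l q lam (((l : ZMod (2*l+1)) + 1) * m).val

/-- The discrete Fourier transform `w̄_lam(q^m) = (1/p) ∑_k (q^m)^k w_lam(q^k)`. -/
def wbar (l : ℕ) (q lam : ℂ) (m : ZMod (2*l+1)) : ℂ :=
  (1 / (2*(l : ℂ)+1)) * ∑ k : ZMod (2*l+1), Qp l q (m * k) * w l q lam k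

/-- Regularity: `mu` avoids the poles `{-q^(2r-1)}` of `w_mu` and `w̄_mu`. -/
def Reg (q mu : ℂ) : Prop := ∀ r : ℕ, mu + q ^ (2*r+1) ≠ 0

/-- `ε = -i q^(-1/2)` with `q^(1/2) := q^(l+1)`. -/
def eps (l : ℕ) (q : ℂ) : ℂ := -Complex.I * (q ^ (l+1))⁻¹

/-- The operator `u_n` (with classical parameter `u n`), acting as multiplication
by `u n * z_n`. -/
def uop (l : ℕ) {N : ℕ} (q : ℂ) (u : Fin N → ℂ) (n : Fin N) :
    Matrix (Idx l N) (Idx l N) ℂ :=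
  Matrix.diagonal fun k => u n * Qp l q (k n)

/-- The inverse of `u_n`. -/
def uopInv (l : ℕ) {N : ℕ} (q : ℂ) (u : Fin N → ℂ) (n : Fin N) :
    Matrix (Idx l N) (Idx l N) ℂ :=
  Matrix.diagonal fun k => (u n)⁻¹ * Qp l q (-(k n))

/-- The operator `v_n` (with classical parameter `v n`): `(v_n ψ)(z) = v n * ψ(..., q⁻¹ z_n, ...)`. -/
def vop (l : ℕ) {N : ℕ} (v : Fin N → ℂ) (n : Fin N) :
    Matrix (Idx l N) (Idx l N) ℂ :=
  fun k k' => if k' = Function.update k n (k n - 1) then v n else 0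

/-- The inverse of `v_n`. -/
def vopInv (l : ℕ) {N : ℕ} (v : Fin N → ℂ) (n : Fin N) :
    Matrix (Idx l N) (Idx l N) ℂ :=
  fun k k' => if k' = Function.update k n (k n + 1) then (v n)⁻¹ else 0

/-- The Lax matrix `L_n(lam)` of the lattice Sine-Gordon model, a `2×2` matrix with
operator entries. -/
def Lax (l : ℕ) {N : ℕ} (q : ℂ) (κ ξ u v : Fin N → ℂ) (lam : ℂ) (n : Fin N) :
    Matrix (Fin 2) (Fin 2) (Matrix (Idx l N) (Idx l N) ℂ) :=
  (κ n / Complex.I) • !![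
    Complex.I • (uop l q u n *
      (((q ^ (l+1))⁻¹ * κ n) • vop l v n + (q ^ (l+1) * (κ n)⁻¹) • vopInv l v n)),
    (lam / ξ n) • vop l v n - (lam / ξ n)⁻¹ • vopInv l v n ;
    (lam / ξ n) • vopInv l v n - (lam / ξ n)⁻¹ • vop l v n,
    Complex.I • (uopInv l q u n *
      ((q ^ (l+1) * (κ n)⁻¹) • vop l v n + ((q ^ (l+1))⁻¹ * κ n) • vopInv l v n))]

/-- The monodromy matrix `M(lam) = L_N(lam) ⋯ L_1(lam)`. -/
def Mon (l : ℕ) {N : ℕ} (q : ℂ) (κ ξ u v : Fin N → ℂ) (lam : ℂ) :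
    Matrix (Fin 2) (Fin 2) (Matrix (Idx l N) (Idx l N) ℂ) :=
  ((List.ofFn fun n : Fin N => Lax l q κ ξ u v lam n).reverse).prod

/-- The transfer matrix `T(lam) = A(lam) + D(lam)`. -/
def Top (l : ℕ) {N : ℕ} (q : ℂ) (κ ξ u v : Fin N → ℂ) (lam : ℂ) :
    Matrix (Idx l N) (Idx l N) ℂ :=
  Mon l q κ ξ u v lam 0 0 + Mon l q κ ξ u v lam 1 1

/-- The operator `Y(lam)`, defined by its matrix elements. -/
def Yop (l : ℕ) {N : ℕ} [NeZero N] (q : ℂ) (κ ξ : Fin N → ℂ) (lam : ℂ) :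
    Matrix (Idx l N) (Idx l N) ℂ :=
  fun k k' => ∏ n : Fin N,
    wbar l q (eps l q * lam / (κ n * ξ n)) (k n - k' n) *
      w l q (eps l q * lam * κ n / ξ n) (k n + k' (n + 1))

/-- Regularity of all the `w`- and `w̄`-factors defining `Y(lam)`. -/
def RegY (l : ℕ) {N : ℕ} (q : ℂ) (κ ξ : Fin N → ℂ) (lam : ℂ) : Prop :=
  ∀ n : Fin N, Reg q (eps l q * lam / (κ n * ξ n)) ∧ Reg q (eps l q * lam * κ n / ξ n)

/-- The Baxter Q-operator `Q(lam, mu) = Y(lam) · Y(conj mu)†`. -/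
def Qop (l : ℕ) {N : ℕ} [NeZero N] (q : ℂ) (κ ξ : Fin N → ℂ) (lam mu : ℂ) :
    Matrix (Idx l N) (Idx l N) ℂ :=
  Yop l q κ ξ lam * (Yop l q κ ξ (starRingEnd ℂ mu))ᴴ

/-- The coefficient function `a_N(lam)` of the Baxter equation. -/
def aN (l : ℕ) {N : ℕ} (q : ℂ) (κ ξ : Fin N → ℂ) (lam : ℂ) : ℂ :=
  (-Complex.I) ^ N * ∏ r : Fin N,
    κ r / (lam / ξ r) * (1 + Complex.I * (q ^ (l+1))⁻¹ * (lam / ξ r) * κ r) *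
      (1 + Complex.I * (q ^ (l+1))⁻¹ * (lam / ξ r) / κ r)

/-- The coefficient function `d_N(lam)` of the Baxter equation. -/
def dN (l : ℕ) {N : ℕ} (q : ℂ) (κ ξ : Fin N → ℂ) (lam : ℂ) : ℂ :=
  Complex.I ^ N * ∏ r : Fin N,
    κ r / (lam / ξ r) * (1 - Complex.I * q ^ (l+1) * (lam / ξ r) * κ r) *
      (1 - Complex.I * q ^ (l+1) * (lam / ξ r) / κ r)

/-- The Θ-charge `Θ = ∏_{n=1}^N v_n^((-1)^(1+n)) = v_1 v_2⁻¹ v_3 v_4⁻¹ ⋯` (unit parameters). -/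
def Theta (l : ℕ) {N : ℕ} : Matrix (Idx l N) (Idx l N) ℂ :=
  (List.ofFn fun n : Fin N =>
    if Even (n : ℕ) then vop l (fun _ : Fin N => (1:ℂ)) n
    else vopInv l (fun _ : Fin N => (1:ℂ)) n).prod

/-- The scalar auxiliary R-matrix on `ℂ² ⊗ ℂ²`. -/
def Rmat (q lam : ℂ) : Matrix (Fin 2 × Fin 2) (Fin 2 × Fin 2) ℂ :=
  fun a b =>
    if a = b then (if a.1 = a.2 then q * lam - q⁻¹ * lam⁻¹ else lam - lam⁻¹)
    else if a.1 = b.2 ∧ a.2 = b.1 then q - q⁻¹ else 0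

/-- The R-matrix with entries viewed as scalar multiples of the identity operator on `H`. -/
def Rop (l N : ℕ) (q lam : ℂ) :
    Matrix (Fin 2 × Fin 2) (Fin 2 × Fin 2) (Matrix (Idx l N) (Idx l N) ℂ) :=
  (Rmat q lam).map fun c => c • (1 : Matrix (Idx l N) (Idx l N) ℂ)

/-- The classical (average) Lax matrix `𝓛_n(Λ)`, a scalar 2×2 matrix, built from
`K_n = κ_n^p`, `X_n = ξ_n^p`, `U_n = u_n^p`, `V_n = v_n^p`. -/
def Lcl (l : ℕ) {N : ℕ} (κ ξ u v : Fin N → ℂ) (L : ℂ) (n : Fin N) :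
    Matrix (Fin 2) (Fin 2) ℂ :=
  (1 / Complex.I ^ (2*l+1)) • !![
    Complex.I ^ (2*l+1) * (u n) ^ (2*l+1) *
      (((κ n) ^ (2*l+1)) ^ 2 * (v n) ^ (2*l+1) + ((v n) ^ (2*l+1))⁻¹),
    (κ n) ^ (2*l+1) * (L * (v n) ^ (2*l+1) / (ξ n) ^ (2*l+1)
      - (ξ n) ^ (2*l+1) / ((v n) ^ (2*l+1) * L)) ;
    (κ n) ^ (2*l+1) * (L / ((ξ n) ^ (2*l+1) * (v n) ^ (2*l+1))
      - (ξ n) ^ (2*l+1) * (v n) ^ (2*l+1) / L),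
    Complex.I ^ (2*l+1) * ((u n) ^ (2*l+1))⁻¹ *
      (((κ n) ^ (2*l+1)) ^ 2 * ((v n) ^ (2*l+1))⁻¹ + (v n) ^ (2*l+1))]

/-- The product `𝓛_N(Λ) 𝓛_{N-1}(Λ) ⋯ 𝓛_1(Λ)` of the classical Lax matrices. -/
def LclProd (l : ℕ) {N : ℕ} (κ ξ u v : Fin N → ℂ) (L : ℂ) : Matrix (Fin 2) (Fin 2) ℂ :=
  ((List.ofFn fun n : Fin N => Lcl l κ ξ u v L n).reverse).prod

/-- The average `𝒪(Λ) = ∏_{k=1}^{p} O(q^k λ)` of the monodromy matrix entry `M(·) i j`. -/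
def avgEntry (l : ℕ) {N : ℕ} (q : ℂ) (κ ξ u v : Fin N → ℂ) (i j : Fin 2) (lam : ℂ) :
    Matrix (Idx l N) (Idx l N) ℂ :=
  (List.ofFn fun k : Fin (2*l+1) => Mon l q κ ξ u v (q ^ ((k : ℕ) + 1) * lam) i j).prod

/-- The kernel matrix `Y_0`, `(Y_0)_{k,k'} = ∏_n q^(-2 k_n (k'_n + k'_{n+1}))`. -/
def Y0mat (l : ℕ) {N : ℕ} [NeZero N] (q : ℂ) : Matrix (Idx l N) (Idx l N) ℂ :=
  fun k k' => ∏ n : Fin N, Qp l q (-(2 * k n * (k' n + k' (n + 1))))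

/-- The kernel matrix `Y_∞`, `(Y_∞)_{k,k'} = ∏_n q^(+2 k_n (k'_n + k'_{n+1}))`. -/
def Yinfmat (l : ℕ) {N : ℕ} [NeZero N] (q : ℂ) : Matrix (Idx l N) (Idx l N) ℂ :=
  fun k k' => ∏ n : Fin N, Qp l q (2 * k n * (k' n + k' (n + 1)))

end SG

open SG

namespace SG

/-- Kronecker product with the identity on the right commutes with products. -/
lemma kr_mul_left {A : Type*} [Ring A] (X Y : Matrix (Fin 2) (Fin 2) A) :
    Matrix.kroneckerMap (· * ·) (X * Y) (1 : Matrix (Fin 2) (Fin 2) A)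
      = Matrix.kroneckerMap (· * ·) X (1 : Matrix (Fin 2) (Fin 2) A)
        * Matrix.kroneckerMap (· * ·) Y (1 : Matrix (Fin 2) (Fin 2) A) := by
  ext ⟨i, j⟩ ⟨k, m⟩
  fin_cases j <;> fin_cases m <;>
    simp [Matrix.mul_apply, Fintype.sum_prod_type, Fin.sum_univ_two, Matrix.one_apply]

lemma kr_mul_right {A : Type*} [Ring A] (X Y : Matrix (Fin 2) (Fin 2) A) :
    Matrix.kroneckerMap (· * ·) (1 : Matrix (Fin 2) (Fin 2) A) (X * Y)
      = Matrix.kroneckerMap (· * ·) (1 : Matrix (Fin 2) (Fin 2) A) X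
        * Matrix.kroneckerMap (· * ·) (1 : Matrix (Fin 2) (Fin 2) A) Y := by
  ext ⟨i, j⟩ ⟨k, m⟩
  fin_cases i <;> fin_cases k <;>
    simp [Matrix.mul_apply, Fintype.sum_prod_type, Fin.sum_univ_two, Matrix.one_apply]

lemma kr_comm {A : Type*} [Ring A] (X Y : Matrix (Fin 2) (Fin 2) A)
    (h : ∀ i j k m, Commute (X i j) (Y k m)) :
    Matrix.kroneckerMap (· * ·) X (1 : Matrix (Fin 2) (Fin 2) A)
        * Matrix.kroneckerMap (· * ·) (1 : Matrix (Fin 2) (Fin 2) A) Y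
      = Matrix.kroneckerMap (· * ·) (1 : Matrix (Fin 2) (Fin 2) A) Y
        * Matrix.kroneckerMap (· * ·) X (1 : Matrix (Fin 2) (Fin 2) A) := by
  ext ⟨i, j⟩ ⟨k, m⟩
  have hcomm := (h i k j m).eq
  fin_cases i <;> fin_cases j <;> fin_cases k <;> fin_cases m <;>
    simpa [Matrix.mul_apply, Fintype.sum_prod_type, Fin.sum_univ_two, Matrix.one_apply] using hcomm

/-- The exchange relation for a pair of `2×2` matrices. -/
def RTT {A : Type*} [Ring A] (R : Matrix (Fin 2 × Fin 2) (Fin 2 × Fin 2) A)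
    (X Y : Matrix (Fin 2) (Fin 2) A) : Prop :=
  R * Matrix.kroneckerMap (· * ·) X (1 : Matrix (Fin 2) (Fin 2) A)
      * Matrix.kroneckerMap (· * ·) (1 : Matrix (Fin 2) (Fin 2) A) Y
    = Matrix.kroneckerMap (· * ·) (1 : Matrix (Fin 2) (Fin 2) A) Y
      * Matrix.kroneckerMap (· * ·) X (1 : Matrix (Fin 2) (Fin 2) A) * R

lemma RTT.mul {A : Type*} [Ring A] {R : Matrix (Fin 2 × Fin 2) (Fin 2 × Fin 2) A}
    {X Y X' Y' : Matrix (Fin 2) (Fin 2) A} (h : RTT R X Y) (h' : RTT R X' Y')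
    (c : ∀ i j k m, Commute (X' i j) (Y k m)) (c' : ∀ i j k m, Commute (X i j) (Y' k m)) :
    RTT R (X * X') (Y * Y') := by
  unfold RTT at *
  rw [kr_mul_left, kr_mul_right]
  have e := kr_comm _ _ c
  have e' := kr_comm _ _ c'
  generalize Matrix.kroneckerMap (· * ·) X (1 : Matrix (Fin 2) (Fin 2) A) = a at *
  generalize Matrix.kroneckerMap (· * ·) X' (1 : Matrix (Fin 2) (Fin 2) A) = a' at *
  generalize Matrix.kroneckerMap (· * ·) (1 : Matrix (Fin 2) (Fin 2) A) Y = b at *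
  generalize Matrix.kroneckerMap (· * ·) (1 : Matrix (Fin 2) (Fin 2) A) Y' = b' at *
  calc R * (a * a') * (b * b') = R * a * (a' * b) * b' := by noncomm_ring
    _ = (R * a * b) * a' * b' := by rw [e]; noncomm_ring
    _ = b * a * (R * a' * b') := by rw [h]; noncomm_ring
    _ = b * (a * b') * a' * R := by rw [h']; noncomm_ring
    _ = b * b' * (a * a') * R := by rw [e']; noncomm_ring

lemma RTT.smul {A : Type*} [Ring A] [Algebra ℂ A]
    {R : Matrix (Fin 2 × Fin 2) (Fin 2 × Fin 2) A}
    {X Y : Matrix (Fin 2) (Fin 2) A} (h : RTT R X Y) (c : ℂ) : RTT R (c • X) (c • Y) := by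
  unfold RTT at *
  have e1 : Matrix.kroneckerMap (· * ·) (c • X) (1 : Matrix (Fin 2) (Fin 2) A)
      = c • Matrix.kroneckerMap (· * ·) X (1 : Matrix (Fin 2) (Fin 2) A) := by
    ext i j; simp
  have e2 : Matrix.kroneckerMap (· * ·) (1 : Matrix (Fin 2) (Fin 2) A) (c • Y)
      = c • Matrix.kroneckerMap (· * ·) (1 : Matrix (Fin 2) (Fin 2) A) Y := by
    ext i j; simp
  rw [e1, e2]
  simp only [Matrix.mul_smul, Matrix.smul_mul, h]

set_option maxHeartbeats 4000000 in
/-- The local exchange relation in an abstract algebra. -/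
lemma local_RTT {A : Type*} [Ring A] [Algebra ℂ A] (s k x y : ℂ) (hs : s ≠ 0) (hk : k ≠ 0)
    (hx : x ≠ 0) (hy : y ≠ 0) (U U' V V' : A)
    (hUU : U * U' = -1) (hUU' : U' * U = -1) (hVV : V * V' = 1) (hVV' : V' * V = 1)
    (h1 : V * U = (s ^ 2)⁻¹ • (U * V)) (h2 : V * U' = (s ^ 2) • (U' * V))
    (h3 : V' * U = (s ^ 2) • (U * V')) (h4 : V' * U' = (s ^ 2)⁻¹ • (U' * V')) :
    RTT ((Rmat (s ^ 2) (x / y)).map fun c => c • (1 : A))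
      (!![U * ((s⁻¹ * k) • V + (s * k⁻¹) • V'), x • V - x⁻¹ • V';
        x • V' - x⁻¹ • V, U' * ((s * k⁻¹) • V + (s⁻¹ * k) • V')])
      (!![U * ((s⁻¹ * k) • V + (s * k⁻¹) • V'), y • V - y⁻¹ • V';
        y • V' - y⁻¹ • V, U' * ((s * k⁻¹) • V + (s⁻¹ * k) • V')]) := by
  have h1' (z : A) : V * (U * z) = (s ^ 2)⁻¹ • (U * (V * z)) := by
    rw [← mul_assoc, h1, smul_mul_assoc, mul_assoc]
  have h2' (z : A) : V * (U' * z) = (s ^ 2) • (U' * (V * z)) := by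
    rw [← mul_assoc, h2, smul_mul_assoc, mul_assoc]
  have h3' (z : A) : V' * (U * z) = (s ^ 2) • (U * (V' * z)) := by
    rw [← mul_assoc, h3, smul_mul_assoc, mul_assoc]
  have h4' (z : A) : V' * (U' * z) = (s ^ 2)⁻¹ • (U' * (V' * z)) := by
    rw [← mul_assoc, h4, smul_mul_assoc, mul_assoc]
  have a1 (z : A) : U * (U' * z) = - z := by rw [← mul_assoc, hUU]; simp
  have a2 (z : A) : U' * (U * z) = - z := by rw [← mul_assoc, hUU']; simp
  unfold RTT
  ext ⟨i, j⟩ ⟨m, n⟩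
  fin_cases i <;> fin_cases j <;> fin_cases m <;> fin_cases n <;>
    simp [Matrix.mul_apply, Fintype.sum_prod_type, Fin.sum_univ_two, Matrix.one_apply, Rmat] <;>
    (try simp only [mul_add, add_mul, mul_sub, sub_mul, smul_mul_assoc, mul_smul_comm, mul_assoc,
      h1, h2, h3, h4, h1', h2', h3', h4', a1, a2, hUU, hUU', hVV, hVV']) <;>
    (match_scalars <;> field_simp <;> ring)

end SG

namespace SG

/-- A generic shift operator, covering `vop` and `vopInv`. -/
def shf (l : ℕ) {N : ℕ} (n : Fin N) (a : ZMod (2*l+1)) (c : ℂ) :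
    Matrix (Idx l N) (Idx l N) ℂ :=
  fun k k' => if k' = Function.update k n (k n + a) then c else 0

lemma vop_eq (l : ℕ) {N : ℕ} (v : Fin N → ℂ) (n : Fin N) : vop l v n = shf l n (-1) (v n) := by
  ext k k'; simp [vop, shf, sub_eq_add_neg]

lemma vopInv_eq (l : ℕ) {N : ℕ} (v : Fin N → ℂ) (n : Fin N) :
    vopInv l v n = shf l n 1 (v n)⁻¹ := rfl

lemma shf_mul_apply (l : ℕ) {N : ℕ} (n : Fin N) (a : ZMod (2*l+1)) (c : ℂ)
    (B : Matrix (Idx l N) (Idx l N) ℂ) (k k' : Idx l N) :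
    (shf l n a c * B) k k' = c * B (Function.update k n (k n + a)) k' := by
  simp [Matrix.mul_apply, shf]

lemma shf_inv (l : ℕ) {N : ℕ} (n : Fin N) (a b : ZMod (2*l+1)) (hab : a + b = 0) (c d : ℂ)
    (hcd : c * d = 1) : shf l n a c * shf l n b d = 1 := by
  ext k k'
  rw [shf_mul_apply]
  simp [shf, add_assoc, hab, Matrix.one_apply, hcd, eq_comm]

lemma shf_comm (l : ℕ) {N : ℕ} {n m : Fin N} (hnm : n ≠ m) (a b : ZMod (2*l+1)) (c d : ℂ) :
    Commute (shf l n a c) (shf l m b d) := by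
  ext k k'
  rw [shf_mul_apply, shf_mul_apply]
  simp only [shf, Function.update_of_ne hnm, Function.update_of_ne hnm.symm,
    Function.update_comm hnm]
  split_ifs <;> ring

lemma shf_diag (l : ℕ) {N : ℕ} (n : Fin N) (a : ZMod (2*l+1)) (c t : ℂ)
    (f : Idx l N → ℂ) (h : ∀ k, f (Function.update k n (k n + a)) = t * f k) :
    shf l n a c * Matrix.diagonal f = t • (Matrix.diagonal f * shf l n a c) := by
  ext k k'
  rw [shf_mul_apply, Matrix.smul_apply, Matrix.diagonal_mul, Matrix.diagonal_apply]
  by_cases h' : k' = Function.update k n (k n + a)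
  · subst h'
    simp [shf, h]; ring
  · rw [if_neg (fun e => h' e.symm)]; simp [shf, h']

lemma Qp_add {l : ℕ} {q : ℂ} (hq : q ^ (2*l+1) = 1) (a b : ZMod (2*l+1)) :
    Qp l q (a + b) = Qp l q a * Qp l q b := by
  unfold Qp
  rw [← pow_add, ZMod.val_add, ← pow_eq_pow_mod _ hq]

lemma Qp_one {l : ℕ} (hl : 1 ≤ l) (q : ℂ) : Qp l q 1 = q := by
  have : Fact (1 < 2*l+1) := ⟨by omega⟩
  simp [Qp, ZMod.val_one]

lemma Qp_zero (l : ℕ) (q : ℂ) : Qp l q 0 = 1 := by simp [Qp]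

lemma Qp_neg_mul {l : ℕ} {q : ℂ} (hq : q ^ (2*l+1) = 1) (a : ZMod (2*l+1)) :
    Qp l q (-a) * Qp l q a = 1 := by
  rw [← Qp_add hq]; simp [Qp_zero]

lemma Qp_neg_one {l : ℕ} (hl : 1 ≤ l) {q : ℂ} (hq : q ^ (2*l+1) = 1) : Qp l q (-1) = q⁻¹ := by
  have := Qp_neg_mul hq 1
  rw [Qp_one hl] at this
  exact eq_inv_of_mul_eq_one_left this

lemma Lax_RTT (l N : ℕ) (hl : 1 ≤ l) (q : ℂ) (hq : IsPrimitiveRoot q (2*l+1))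
    (κ ξ u v : Fin N → ℂ) (hκ : ∀ n, κ n ≠ 0) (hξ : ∀ n, ξ n ≠ 0)
    (hu : ∀ n, u n ≠ 0) (hv : ∀ n, v n ≠ 0)
    (lam mu : ℂ) (hlam : lam ≠ 0) (hmu : mu ≠ 0) (n : Fin N) :
    RTT (Rop l N q (lam / mu)) (Lax l q κ ξ u v lam n) (Lax l q κ ξ u v mu n) := by
  have hp : q ^ (2*l+1) = 1 := hq.pow_eq_one
  have hq0 : q ≠ 0 := hq.ne_zero (by omega)
  have hs : (q ^ (l+1)) ^ 2 = q := by
    calc (q ^ (l+1)) ^ 2 = q ^ (2*l+1) * q := by ring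
      _ = q := by rw [hp, one_mul]
  have hUU : uop l q u n * uopInv l q u n = 1 := by
    rw [uop, uopInv, Matrix.diagonal_mul_diagonal, ← Matrix.diagonal_one]
    congr 1; ext k
    have := Qp_neg_mul hp (k n)
    have := hu n
    field_simp
    linear_combination Qp_neg_mul hp (k n)
  have hUU' : uopInv l q u n * uop l q u n = 1 := by
    rw [uop, uopInv, Matrix.diagonal_mul_diagonal, ← Matrix.diagonal_one]
    congr 1; ext k
    have := hu n
    field_simp
    linear_combination Qp_neg_mul hp (k n)
  have hVV : vop l v n * vopInv l v n = 1 := by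
    rw [vop_eq, vopInv_eq]
    exact shf_inv _ _ _ _ (by simp) _ _ (mul_inv_cancel₀ (hv n))
  have hVV' : vopInv l v n * vop l v n = 1 := by
    rw [vop_eq, vopInv_eq]
    exact shf_inv _ _ _ _ (by simp) _ _ (inv_mul_cancel₀ (hv n))
  have h1 : vop l v n * uop l q u n = q⁻¹ • (uop l q u n * vop l v n) := by
    rw [vop_eq]
    refine shf_diag _ _ _ _ _ _ fun k => ?_
    simp only [Function.update_self, Qp_add hp, Qp_neg_one hl hp]; ring
  have h2 : vop l v n * uopInv l q u n = q • (uopInv l q u n * vop l v n) := by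
    rw [vop_eq]
    refine shf_diag _ _ _ _ _ _ fun k => ?_
    simp only [Function.update_self, neg_add, neg_neg, Qp_add hp, Qp_one hl]; ring
  have h3 : vopInv l v n * uop l q u n = q • (uop l q u n * vopInv l v n) := by
    rw [vopInv_eq]
    refine shf_diag _ _ _ _ _ _ fun k => ?_
    simp only [Function.update_self, Qp_add hp, Qp_one hl]; ring
  have h4 : vopInv l v n * uopInv l q u n = q⁻¹ • (uopInv l q u n * vopInv l v n) := by
    rw [vopInv_eq]
    refine shf_diag _ _ _ _ _ _ fun k => ?_
    simp only [Function.update_self, neg_add, Qp_add hp, Qp_neg_one hl hp]; ring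
  have key := RTT.smul (local_RTT (q ^ (l+1)) (κ n) (lam / ξ n) (mu / ξ n) (pow_ne_zero _ hq0)
    (hκ n) (div_ne_zero hlam (hξ n)) (div_ne_zero hmu (hξ n))
    (Complex.I • uop l q u n) (Complex.I • uopInv l q u n) (vop l v n) (vopInv l v n)
    (by rw [smul_mul_smul_comm, hUU, Complex.I_mul_I, neg_one_smul])
    (by rw [smul_mul_smul_comm, hUU', Complex.I_mul_I, neg_one_smul]) hVV hVV'
    (by rw [hs, mul_smul_comm, smul_mul_assoc, h1, smul_comm])
    (by rw [hs, mul_smul_comm, smul_mul_assoc, h2, smul_comm])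
    (by rw [hs, mul_smul_comm, smul_mul_assoc, h3, smul_comm])
    (by rw [hs, mul_smul_comm, smul_mul_assoc, h4, smul_comm])) (κ n / Complex.I)
  rw [hs, div_div_div_cancel_right₀ (hξ n)] at key
  simpa only [Rop, Lax, smul_mul_assoc] using key

/-- Operators at different sites commute. -/
lemma diag_shf_comm (l : ℕ) {N : ℕ} (n : Fin N) (a : ZMod (2*l+1)) (c : ℂ)
    (f : Idx l N → ℂ) (h : ∀ k, f (Function.update k n (k n + a)) = f k) :
    Commute (Matrix.diagonal f) (shf l n a c) := by
  have := shf_diag l n a c 1 f (by simpa using h)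
  rw [one_smul] at this
  exact this.symm

lemma entry_comm {A : Type*} [Ring A] [Algebra ℂ A] {X U U' V V' : A} (h1 : Commute X U)
    (h2 : Commute X U') (h3 : Commute X V) (h4 : Commute X V')
    (c d a1 a2 b1 b2 c1 c2 d' d1 d2 : ℂ) (i j : Fin 2) :
    Commute X ((c • !![d • (U * (a1 • V + a2 • V')), b1 • V - b2 • V';
      c1 • V' - c2 • V, d' • (U' * (d1 • V + d2 • V'))] : Matrix (Fin 2) (Fin 2) A) i j) := by
  rw [Matrix.smul_apply]
  refine Commute.smul_right ?_ c
  fin_cases i <;> fin_cases j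
  · exact (h1.mul_right ((h3.smul_right a1).add_right (h4.smul_right a2))).smul_right d
  · exact (h3.smul_right b1).sub_right (h4.smul_right b2)
  · exact (h4.smul_right c1).sub_right (h3.smul_right c2)
  · exact (h2.mul_right ((h3.smul_right d1).add_right (h4.smul_right d2))).smul_right d'

lemma Lax_comm (l N : ℕ) (q : ℂ) (κ ξ u v : Fin N → ℂ) (lam mu : ℂ) {n m : Fin N} (h : n ≠ m)
    (i j i' j' : Fin 2) :
    Commute (Lax l q κ ξ u v lam n i j) (Lax l q κ ξ u v mu m i' j') := by
  have vv : Commute (vop l v n) (vop l v m) := by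
    rw [vop_eq, vop_eq]; exact shf_comm _ h _ _ _ _
  have vw : Commute (vop l v n) (vopInv l v m) := by
    rw [vop_eq, vopInv_eq]; exact shf_comm _ h _ _ _ _
  have wv : Commute (vopInv l v n) (vop l v m) := by
    rw [vop_eq, vopInv_eq]; exact shf_comm _ h _ _ _ _
  have ww : Commute (vopInv l v n) (vopInv l v m) := by
    rw [vopInv_eq, vopInv_eq]; exact shf_comm _ h _ _ _ _
  have dd (f g : Idx l N → ℂ) : Commute (Matrix.diagonal f) (Matrix.diagonal g) := by
    rw [Commute, SemiconjBy, Matrix.diagonal_mul_diagonal, Matrix.diagonal_mul_diagonal]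
    congr 1; ext; ring
  have uu : Commute (uop l q u n) (uop l q u m) := dd _ _
  have ux : Commute (uop l q u n) (uopInv l q u m) := dd _ _
  have xu : Commute (uopInv l q u n) (uop l q u m) := dd _ _
  have xx : Commute (uopInv l q u n) (uopInv l q u m) := dd _ _
  have uv : Commute (uop l q u n) (vop l v m) := by
    rw [vop_eq]; exact diag_shf_comm _ _ _ _ _ fun k => by simp [Function.update_of_ne h]
  have uw : Commute (uop l q u n) (vopInv l v m) := by
    rw [vopInv_eq]; exact diag_shf_comm _ _ _ _ _ fun k => by simp [Function.update_of_ne h]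
  have xv : Commute (uopInv l q u n) (vop l v m) := by
    rw [vop_eq]; exact diag_shf_comm _ _ _ _ _ fun k => by simp [Function.update_of_ne h]
  have xw : Commute (uopInv l q u n) (vopInv l v m) := by
    rw [vopInv_eq]; exact diag_shf_comm _ _ _ _ _ fun k => by simp [Function.update_of_ne h]
  have vu : Commute (vop l v n) (uop l q u m) := by
    rw [vop_eq]; exact (diag_shf_comm _ _ _ _ _ fun k => by simp [Function.update_of_ne h.symm]).symm
  have wu : Commute (vopInv l v n) (uop l q u m) := by
    rw [vopInv_eq]; exact (diag_shf_comm _ _ _ _ _ fun k => by simp [Function.update_of_ne h.symm]).symm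
  have vx : Commute (vop l v n) (uopInv l q u m) := by
    rw [vop_eq]; exact (diag_shf_comm _ _ _ _ _ fun k => by simp [Function.update_of_ne h.symm]).symm
  have wx : Commute (vopInv l v n) (uopInv l q u m) := by
    rw [vopInv_eq]; exact (diag_shf_comm _ _ _ _ _ fun k => by simp [Function.update_of_ne h.symm]).symm
  have step (X : Matrix (Idx l N) (Idx l N) ℂ) (h1 : Commute X (uop l q u m))
      (h2 : Commute X (uopInv l q u m)) (h3 : Commute X (vop l v m))
      (h4 : Commute X (vopInv l v m)) : Commute X (Lax l q κ ξ u v mu m i' j') := by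
    exact entry_comm h1 h2 h3 h4 _ _ _ _ _ _ _ _ _ _ _ i' j'
  have hU := step _ uu ux uv uw
  have hX := step _ xu xx xv xw
  have hV := step _ vu vx vv vw
  have hW := step _ wu wx wv ww
  generalize Lax l q κ ξ u v mu m i' j' = Z at hU hX hV hW ⊢
  exact (entry_comm hU.symm hX.symm hV.symm hW.symm _ _ _ _ _ _ _ _ _ _ _ i j).symm

lemma prod_comm {A ι : Type*} [Ring A] (F : ι → Matrix (Fin 2) (Fin 2) A)
    (X : A) (L : List ι) (h : ∀ n ∈ L, ∀ i j, Commute X (F n i j)) (i j : Fin 2) :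
    Commute X ((L.map F).prod i j) := by
  induction L generalizing i j with
  | nil =>
    simp only [List.map_nil, List.prod_nil, Matrix.one_apply]
    split_ifs
    · exact Commute.one_right _
    · exact Commute.zero_right _
  | cons n L ih =>
    simp only [List.map_cons, List.prod_cons, Matrix.mul_apply]
    refine Commute.sum_right _ _ _ fun k _ => ?_
    exact (h n (by simp) i k).mul_right (ih (fun m hm => h m (by simp [hm])) k j)

lemma RTT_list {A ι : Type*} [Ring A] (R : Matrix (Fin 2 × Fin 2) (Fin 2 × Fin 2) A)
    (F G : ι → Matrix (Fin 2) (Fin 2) A) (hR : ∀ n, RTT R (F n) (G n))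
    (hc : ∀ n m, n ≠ m → ∀ i j i' j', Commute (F n i j) (G m i' j'))
    (L : List ι) (hL : L.Nodup) : RTT R (L.map F).prod (L.map G).prod := by
  induction L with
  | nil =>
    have : Matrix.kroneckerMap (· * ·) (1 : Matrix (Fin 2) (Fin 2) A)
      (1 : Matrix (Fin 2) (Fin 2) A) = 1 :=
      Matrix.kroneckerMap_one_one _ (by simp) (by simp) (by simp)
    simp [RTT, this]
  | cons n L ih =>
    rw [List.nodup_cons] at hL
    simp only [List.map_cons, List.prod_cons]
    refine RTT.mul (hR n) (ih hL.2) (fun i j k m => ?_) (fun i j k m => ?_)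
    · refine (prod_comm F _ L (fun m' hm i j => ?_) i j).symm
      exact (hc m' n (fun e => hL.1 (e ▸ hm)) _ _ _ _).symm
    · refine prod_comm G _ L (fun m' hm i j => ?_) k m
      exact hc n m' (fun e => hL.1 (e ▸ hm)) _ _ _ _

lemma Mon_eq (l : ℕ) {N : ℕ} (q : ℂ) (κ ξ u v : Fin N → ℂ) (lam : ℂ) :
    Mon l q κ ξ u v lam = ((List.finRange N).reverse.map (Lax l q κ ξ u v lam)).prod := by
  rw [Mon, List.ofFn_eq_map, List.map_reverse]

end SG

/-- **Yang–Baxter algebra relation**: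
`R(λ/μ)·(M(λ)⊗I)·(I⊗M(μ)) = (I⊗M(μ))·(M(λ)⊗I)·R(λ/μ)`. -/
theorem yang_baxter_relation (l N : ℕ) (hl : 1 ≤ l)
    (q : ℂ) (hq : IsPrimitiveRoot q (2*l+1))
    (κ ξ u v : Fin N → ℂ) (hκ : ∀ n, κ n ≠ 0) (hξ : ∀ n, ξ n ≠ 0)
    (hu : ∀ n, u n ≠ 0) (hv : ∀ n, v n ≠ 0)
    (lam mu : ℂ) (hlam : lam ≠ 0) (hmu : mu ≠ 0) :
    Rop l N q (lam / mu)
        * Matrix.kroneckerMap (· * ·) (Mon l q κ ξ u v lam)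
            (1 : Matrix (Fin 2) (Fin 2) (Matrix (Idx l N) (Idx l N) ℂ))
        * Matrix.kroneckerMap (· * ·)
            (1 : Matrix (Fin 2) (Fin 2) (Matrix (Idx l N) (Idx l N) ℂ))
            (Mon l q κ ξ u v mu)
      = Matrix.kroneckerMap (· * ·)
            (1 : Matrix (Fin 2) (Fin 2) (Matrix (Idx l N) (Idx l N) ℂ))
            (Mon l q κ ξ u v mu)
        * Matrix.kroneckerMap (· * ·) (Mon l q κ ξ u v lam)
            (1 : Matrix (Fin 2) (Fin 2) (Matrix (Idx l N) (Idx l N) ℂ))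
        * Rop l N q (lam / mu) := by
  have := RTT_list (Rop l N q (lam / mu)) (Lax l q κ ξ u v lam) (Lax l q κ ξ u v mu)
    (Lax_RTT l N hl q hq κ ξ u v hκ hξ hu hv lam mu hlam hmu)
    (fun n m h i j i' j' => Lax_comm l N q κ ξ u v lam mu h i j i' j')
    (List.finRange N).reverse (List.nodup_reverse.2 (List.nodup_finRange N))
  rw [← Mon_eq, ← Mon_eq] at this
  exact this
end
end

section
/- (Commutativity of transfer matrices.) For all λ, μ ∈ ℂ∖{0}, the transfer matrices commute: T(λ)·T(μ) = T(μ)·T(λ) as operators on H. -/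
open scoped BigOperators Matrix

noncomputable section

open SG
set_option linter.all false
set_option linter.unusedSimpArgs false
set_option linter.unusedSectionVars false

namespace SGProof

open Matrix

section Abstract

variable {E : Type*} [Ring E] [Algebra ℂ E]

/-- tensor product of two operator-valued matrices, first factor first -/
def P (X Y : Matrix (Fin 2) (Fin 2) E) : Matrix (Fin 2 × Fin 2) (Fin 2 × Fin 2) E :=
  fun a b => X a.1 b.1 * Y a.2 b.2

/-- tensor product of two operator-valued matrices, second factor first -/
def Q (X Y : Matrix (Fin 2) (Fin 2) E) : Matrix (Fin 2 × Fin 2) (Fin 2 × Fin 2) E :=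
  fun a b => Y a.2 b.2 * X a.1 b.1

/-- The `RLL` relation. -/
def Rel (q x : ℂ) (X Y : Matrix (Fin 2) (Fin 2) E) : Prop :=
  (Rmat q x).map (algebraMap ℂ E) * P X Y = Q X Y * (Rmat q x).map (algebraMap ℂ E)

lemma P_mul (X Y X' Y' : Matrix (Fin 2) (Fin 2) E)
    (h : ∀ i j k m, Commute (X' i j) (Y k m)) : P (X * X') (Y * Y') = P X Y * P X' Y' := by
  ext a b
  simp only [P, Matrix.mul_apply, Fintype.sum_prod_type, Fin.sum_univ_two, mul_add, add_mul]
  have e : ∀ i j k m, ∀ s t : E, s * X' i j * (Y k m * t) = s * Y k m * (X' i j * t) := by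
    intro i j k m s t
    rw [mul_assoc, ← mul_assoc (X' i j), (h i j k m).eq, mul_assoc, mul_assoc]
  simp only [e]
  abel

lemma Q_mul (X Y X' Y' : Matrix (Fin 2) (Fin 2) E)
    (h : ∀ i j k m, Commute (Y' i j) (X k m)) : Q (X * X') (Y * Y') = Q X Y * Q X' Y' := by
  ext a b
  simp only [Q, Matrix.mul_apply, Fintype.sum_prod_type, Fin.sum_univ_two, mul_add, add_mul]
  have e : ∀ i j k m, ∀ s t : E, s * Y' i j * (X k m * t) = s * X k m * (Y' i j * t) := by
    intro i j k m s t
    rw [mul_assoc, ← mul_assoc (Y' i j), (h i j k m).eq, mul_assoc, mul_assoc]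
  simp only [e]
  try abel

lemma Rel.mul {q x : ℂ} {X Y X' Y' : Matrix (Fin 2) (Fin 2) E} (h : Rel q x X Y)
    (h' : Rel q x X' Y') (h1 : ∀ i j k m, Commute (X' i j) (Y k m))
    (h2 : ∀ i j k m, Commute (Y' i j) (X k m)) : Rel q x (X * X') (Y * Y') := by
  unfold Rel at *
  rw [P_mul _ _ _ _ h1, Q_mul _ _ _ _ h2, ← mul_assoc, h, mul_assoc, h', mul_assoc]

lemma Rel.one (q x : ℂ) : Rel q x (1 : Matrix (Fin 2) (Fin 2) E) 1 := by
  have h1 : P (1 : Matrix (Fin 2) (Fin 2) E) 1 = 1 := by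
    ext ⟨a, b⟩ ⟨c, d⟩
    simp [P, Matrix.one_apply, Prod.ext_iff]
    split_ifs <;> simp_all
  have h2 : Q (1 : Matrix (Fin 2) (Fin 2) E) 1 = 1 := by
    ext ⟨a, b⟩ ⟨c, d⟩
    simp [Q, Matrix.one_apply, Prod.ext_iff]
    split_ifs <;> simp_all
  unfold Rel
  rw [h1, h2, mul_one, one_mul]

lemma trace_scalar_comm {ι : Type*} [Fintype ι] (S : Matrix ι ι ℂ) (M : Matrix ι ι E) :
    (S.map (algebraMap ℂ E) * M).trace = (M * S.map (algebraMap ℂ E)).trace := by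
  simp only [Matrix.trace, Matrix.diag, Matrix.mul_apply, Matrix.map_apply]
  rw [Finset.sum_comm]
  simp only [Algebra.commutes]

lemma Rel.trace {q x : ℂ} {X Y : Matrix (Fin 2) (Fin 2) E} (h : Rel q x X Y)
    (S : Matrix (Fin 2 × Fin 2) (Fin 2 × Fin 2) ℂ) (hS : Rmat q x * S = 1) :
    (X 0 0 + X 1 1) * (Y 0 0 + Y 1 1) = (Y 0 0 + Y 1 1) * (X 0 0 + X 1 1) := by
  have hS' : (Rmat q x).map (algebraMap ℂ E) * S.map (algebraMap ℂ E) = 1 := by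
    rw [← Matrix.map_mul, hS]; simp
  have hS'' : S.map (algebraMap ℂ E) * (Rmat q x).map (algebraMap ℂ E) = 1 := by
    rw [← Matrix.map_mul, mul_eq_one_comm.mp hS]; simp
  have e : (P X Y).trace = (Q X Y).trace := by
    have : P X Y = S.map (algebraMap ℂ E) * (Q X Y * (Rmat q x).map (algebraMap ℂ E)) := by
      rw [← h, ← mul_assoc, hS'', one_mul]
    rw [this, trace_scalar_comm, mul_assoc, hS', mul_one]
  simp only [Matrix.trace, Matrix.diag, P, Q, Fintype.sum_prod_type, Fin.sum_univ_two] at e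
  simp only [mul_add, add_mul]
  calc _ = X 0 0 * Y 0 0 + X 0 0 * Y 1 1 + (X 1 1 * Y 0 0 + X 1 1 * Y 1 1) := by abel
    _ = _ := e
    _ = _ := by abel

lemma Rmat_inv (q x : ℂ) (hq : q ≠ 0) (hx : x ≠ 0) (h1 : x ^ 2 * q ^ 2 - 1 ≠ 0)
    (h2 : x ^ 2 - q ^ 2 ≠ 0) : ∃ S, Rmat q x * S = 1 := by
  have ha : q * x - q⁻¹ * x⁻¹ ≠ 0 := by
    intro h; apply h1; field_simp at h; linear_combination h
  have hb : (x - x⁻¹) ^ 2 - (q - q⁻¹) ^ 2 ≠ 0 := by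
    intro h
    have : (x ^ 2 * q ^ 2 - 1) * (x ^ 2 - q ^ 2) = 0 := by
      field_simp at h; linear_combination h
    exact (mul_ne_zero h1 h2) this
  generalize hA : q * x - q⁻¹ * x⁻¹ = a at ha
  generalize hB : x - x⁻¹ = b at hb
  generalize hC : q - q⁻¹ = c at hb
  refine ⟨Matrix.of fun s t => if s = t then (if s.1 = s.2 then a⁻¹ else b / (b ^ 2 - c ^ 2))
    else if s.1 = t.2 ∧ s.2 = t.1 then - c / (b ^ 2 - c ^ 2) else 0, ?_⟩
  ext ⟨i, j⟩ ⟨k, m⟩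
  fin_cases i <;> fin_cases j <;> fin_cases k <;> fin_cases m <;>
    simp [Rmat, Matrix.mul_apply, Fintype.sum_prod_type, Fin.sum_univ_two, hA, hB, hC] <;>
    field_simp <;> ring

set_option maxHeartbeats 4000000 in
lemma rll (s κ lam mu c : ℂ) (hs : s ≠ 0) (hκ : κ ≠ 0) (hl : lam ≠ 0) (hm : mu ≠ 0)
    (U Ui V W : E) (hVW : V * W = 1) (hWV : W * V = 1) (hUUi : U * Ui = 1) (hUiU : Ui * U = 1)
    (h1 : V * U = (s ^ 2)⁻¹ • (U * V)) (h2 : W * U = (s ^ 2) • (U * W))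
    (h3 : V * Ui = (s ^ 2) • (Ui * V)) (h4 : W * Ui = (s ^ 2)⁻¹ • (Ui * W)) :
    Rel (s ^ 2) (lam / mu)
      (c • !![Complex.I • (U * ((s⁻¹ * κ) • V + (s * κ⁻¹) • W)), lam • V - lam⁻¹ • W;
        lam • W - lam⁻¹ • V, Complex.I • (Ui * ((s * κ⁻¹) • V + (s⁻¹ * κ) • W))])
      (c • !![Complex.I • (U * ((s⁻¹ * κ) • V + (s * κ⁻¹) • W)), mu • V - mu⁻¹ • W;
        mu • W - mu⁻¹ • V, Complex.I • (Ui * ((s * κ⁻¹) • V + (s⁻¹ * κ) • W))]) := by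
  have h1' : ∀ t, V * (U * t) = (s ^ 2)⁻¹ • (U * (V * t)) := fun t => by
    rw [← mul_assoc, h1, smul_mul_assoc, mul_assoc]
  have h2' : ∀ t, W * (U * t) = (s ^ 2) • (U * (W * t)) := fun t => by
    rw [← mul_assoc, h2, smul_mul_assoc, mul_assoc]
  have h3' : ∀ t, V * (Ui * t) = (s ^ 2) • (Ui * (V * t)) := fun t => by
    rw [← mul_assoc, h3, smul_mul_assoc, mul_assoc]
  have h4' : ∀ t, W * (Ui * t) = (s ^ 2)⁻¹ • (Ui * (W * t)) := fun t => by
    rw [← mul_assoc, h4, smul_mul_assoc, mul_assoc]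
  have h5 : ∀ t, U * (Ui * t) = t := fun t => by rw [← mul_assoc, hUUi, one_mul]
  have h6 : ∀ t, Ui * (U * t) = t := fun t => by rw [← mul_assoc, hUiU, one_mul]
  have hI : Complex.I ^ 2 = -1 := Complex.I_sq
  unfold Rel
  ext ⟨i, j⟩ ⟨k, m⟩
  fin_cases i <;> fin_cases j <;> fin_cases k <;> fin_cases m <;>
    simp [Rmat, P, Q, Matrix.mul_apply, Fintype.sum_prod_type, Fin.sum_univ_two,
      -map_sub, -map_mul, -map_inv₀, -map_pow, -map_div₀, -inv_pow,
      ← Algebra.commutes, ← Algebra.smul_def] <;>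
    simp only [mul_add, add_mul, mul_sub, sub_mul, smul_add, smul_sub, smul_mul_assoc,
      mul_smul_comm, mul_assoc, h1', h2', h3', h4', h5, h6, hUUi, hUiU, hVW, hWV, h1, h2, h3, h4,
      mul_one, one_mul] <;>
    match_scalars <;> field_simp <;> (try simp only [hI]) <;> ring

end Abstract

section Ops

variable {l N : ℕ} {q : ℂ}

lemma Qp_add (hq : q ^ (2 * l + 1) = 1) (i j : ZMod (2 * l + 1)) :
    Qp l q (i + j) = Qp l q i * Qp l q j := by
  unfold Qp
  rw [ZMod.val_add, ← pow_add, ← pow_mod_orderOf, Nat.mod_mod_of_dvd, pow_mod_orderOf]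
  exact orderOf_dvd_of_pow_eq_one hq

lemma Qp_zero : Qp l q 0 = 1 := by simp [Qp]

lemma Qp_one (hl : 1 ≤ l) : Qp l q 1 = q := by
  have : Fact (1 < 2 * l + 1) := ⟨by omega⟩
  simp [Qp, ZMod.val_one]

lemma Qp_neg (hq : q ^ (2 * l + 1) = 1) (j : ZMod (2 * l + 1)) :
    Qp l q (-j) = (Qp l q j)⁻¹ := by
  apply eq_inv_of_mul_eq_one_left
  rw [← Qp_add hq]; simp [Qp_zero]

lemma Qp_ne (hq : q ^ (2 * l + 1) = 1) (j : ZMod (2 * l + 1)) : Qp l q j ≠ 0 := by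
  intro h
  have := Qp_add hq j (-j)
  rw [h] at this; simp [Qp_zero] at this

/-- A weighted composition operator. -/
def shift (f : Idx l N → Idx l N) (c : ℂ) : Matrix (Idx l N) (Idx l N) ℂ :=
  Matrix.of fun k k' => if k' = f k then c else 0

lemma shift_mul (f g : Idx l N → Idx l N) (c d : ℂ) :
    shift f c * shift g d = shift (fun k => g (f k)) (c * d) := by
  ext k k'
  simp only [shift, Matrix.mul_apply, Matrix.of_apply]
  rw [Finset.sum_eq_single (f k)]
  · simp
  · intro b _ hb
    simp [hb]
  · simp

lemma vop_eq (v : Fin N → ℂ) (n : Fin N) :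
    vop l v n = shift (fun k => Function.update k n (k n + (-1))) (v n) := by
  simp only [← sub_eq_add_neg]; rfl

lemma vopInv_eq (v : Fin N → ℂ) (n : Fin N) :
    vopInv l v n = shift (fun k => Function.update k n (k n + 1)) (v n)⁻¹ := rfl

lemma shift_one : shift (fun k : Idx l N => k) 1 = 1 := by
  ext k k'
  simp [shift, Matrix.one_apply, eq_comm]

lemma VW (v : Fin N → ℂ) (n : Fin N) (hv : v n ≠ 0) : vop l v n * vopInv l v n = 1 := by
  rw [vop_eq, vopInv_eq, shift_mul, mul_inv_cancel₀ hv, ← shift_one]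
  congr 1
  ext k
  simp

lemma WV (v : Fin N → ℂ) (n : Fin N) (hv : v n ≠ 0) : vopInv l v n * vop l v n = 1 :=
  mul_eq_one_comm.mp (VW v n hv)

lemma UUi (hq : q ^ (2 * l + 1) = 1) (u : Fin N → ℂ) (n : Fin N) (hu : u n ≠ 0) :
    uop l q u n * uopInv l q u n = 1 := by
  unfold uop uopInv
  rw [Matrix.diagonal_mul_diagonal, ← Matrix.diagonal_one]
  congr 1; ext k
  have := Qp_ne hq (k n)
  rw [Qp_neg hq]; field_simp

lemma UiU (hq : q ^ (2 * l + 1) = 1) (u : Fin N → ℂ) (n : Fin N) (hu : u n ≠ 0) :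
    uopInv l q u n * uop l q u n = 1 := mul_eq_one_comm.mp (UUi hq u n hu)

lemma VU (hl : 1 ≤ l) (hq : q ^ (2 * l + 1) = 1) (u v : Fin N → ℂ) (n : Fin N) :
    vop l v n * uop l q u n = q⁻¹ • (uop l q u n * vop l v n) := by
  ext k k'
  simp only [uop, vop, Matrix.mul_diagonal, Matrix.diagonal_mul, Matrix.smul_apply, smul_eq_mul]
  split_ifs with h
  · subst h
    simp [sub_eq_add_neg, Qp_add hq, Qp_neg hq, Qp_one hl]; ring
  · simp

lemma WU (hl : 1 ≤ l) (hq : q ^ (2 * l + 1) = 1) (u v : Fin N → ℂ) (n : Fin N) :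
    vopInv l v n * uop l q u n = q • (uop l q u n * vopInv l v n) := by
  ext k k'
  simp only [uop, vopInv, Matrix.mul_diagonal, Matrix.diagonal_mul, Matrix.smul_apply, smul_eq_mul]
  split_ifs with h
  · subst h
    simp [Qp_add hq, Qp_one hl]; ring
  · simp

lemma VUi (hl : 1 ≤ l) (hq : q ^ (2 * l + 1) = 1) (u v : Fin N → ℂ) (n : Fin N) :
    vop l v n * uopInv l q u n = q • (uopInv l q u n * vop l v n) := by
  ext k k'
  simp only [uopInv, vop, Matrix.mul_diagonal, Matrix.diagonal_mul, Matrix.smul_apply, smul_eq_mul]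
  split_ifs with h
  · subst h
    simp [sub_eq_add_neg, Qp_add hq, Qp_neg hq, Qp_one hl]; ring
  · simp

lemma WUi (hl : 1 ≤ l) (hq : q ^ (2 * l + 1) = 1) (u v : Fin N → ℂ) (n : Fin N) :
    vopInv l v n * uopInv l q u n = q⁻¹ • (uopInv l q u n * vopInv l v n) := by
  ext k k'
  simp only [uopInv, vopInv, Matrix.mul_diagonal, Matrix.diagonal_mul, Matrix.smul_apply,
    smul_eq_mul]
  split_ifs with h
  · subst h
    simp [Qp_add hq, Qp_neg hq, Qp_one hl]; ring
  · simp

lemma diag_shift (d : ZMod (2 * l + 1) → ℂ) (n m : Fin N) (h : n ≠ m)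
    (f : Idx l N → ZMod (2 * l + 1)) (c : ℂ) :
    Commute (Matrix.diagonal fun k : Idx l N => d (k n))
      (shift (fun k => Function.update k m (f k)) c) := by
  unfold Commute SemiconjBy
  ext k k'
  simp only [shift, Matrix.mul_diagonal, Matrix.diagonal_mul, Matrix.of_apply]
  split_ifs with h'
  · subst h'
    rw [Function.update_of_ne h]; ring
  · simp

lemma shift_shift (n m : Fin N) (h : n ≠ m) (a b : ZMod (2 * l + 1)) (c d : ℂ) :
    Commute (shift (fun k : Idx l N => Function.update k n (k n + a)) c)
      (shift (fun k => Function.update k m (k m + b)) d) := by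
  unfold Commute SemiconjBy
  rw [shift_mul, shift_mul, mul_comm c d]
  congr 1
  ext1 k
  simp only [Function.update_of_ne h, Function.update_of_ne h.symm]
  rw [Function.update_comm h]

/-- The four generators at a site. -/
def gen (l : ℕ) {N : ℕ} (q : ℂ) (u v : Fin N → ℂ) (n : Fin N) :
    Fin 4 → Matrix (Idx l N) (Idx l N) ℂ :=
  ![uop l q u n, uopInv l q u n, vop l v n, vopInv l v n]

set_option maxHeartbeats 1000000 in
lemma gen_comm (u v : Fin N → ℂ) (n m : Fin N) (h : n ≠ m) (a b : Fin 4) :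
    Commute (gen l q u v n a) (gen l q u v m b) := by
  have hU : ∀ n, uop l q u n = Matrix.diagonal fun k => (fun z => u n * Qp l q z) (k n) :=
    fun n => rfl
  have hUi : ∀ n, uopInv l q u n = Matrix.diagonal fun k =>
    (fun z => (u n)⁻¹ * Qp l q (-z)) (k n) := fun n => rfl
  have dd : ∀ f g : Idx l N → ℂ, Commute (Matrix.diagonal f) (Matrix.diagonal g) :=
    fun f g => Matrix.commute_diagonal f g
  have hd : ∀ (f : ZMod (2 * l + 1) → ℂ) b, Commute (Matrix.diagonal fun k : Idx l N => f (k n))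
      (gen l q u v m b) := by
    intro f b
    fin_cases b
    · exact dd _ _
    · exact dd _ _
    · change Commute _ (vop l v m)
      rw [vop_eq]
      exact diag_shift f n m h (fun k => k m + (-1)) (v m)
    · change Commute _ (vopInv l v m)
      rw [vopInv_eq]
      exact diag_shift f n m h (fun k => k m + 1) (v m)⁻¹
  have hs : ∀ (c : ZMod (2 * l + 1)) d b,
      Commute (shift (fun k : Idx l N => Function.update k n (k n + c)) d)
      (gen l q u v m b) := by
    intro c d b
    fin_cases b
    · change Commute _ (uop l q u m)
      rw [hU]
      exact (diag_shift (fun z => u m * Qp l q z) m n h.symm (fun k => k n + c) d).symm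
    · change Commute _ (uopInv l q u m)
      rw [hUi]
      exact (diag_shift (fun z => (u m)⁻¹ * Qp l q (-z)) m n h.symm (fun k => k n + c) d).symm
    · change Commute _ (vop l v m)
      rw [vop_eq]
      exact shift_shift n m h c (-1) d (v m)
    · change Commute _ (vopInv l v m)
      rw [vopInv_eq]
      exact shift_shift n m h c 1 d (v m)⁻¹
  fin_cases a
  · change Commute (uop l q u n) _
    rw [hU]
    exact hd (fun z => u n * Qp l q z) b
  · change Commute (uopInv l q u n) _
    rw [hUi]
    exact hd (fun z => (u n)⁻¹ * Qp l q (-z)) b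
  · change Commute (vop l v n) _
    rw [vop_eq]
    exact hs (-1) (v n) b
  · change Commute (vopInv l v n) _
    rw [vopInv_eq]
    exact hs 1 (v n)⁻¹ b

lemma comm_Lax (κ ξ u v : Fin N → ℂ) (lam : ℂ) (n : Fin N) (X : Matrix (Idx l N) (Idx l N) ℂ)
    (hX : ∀ a, Commute X (gen l q u v n a)) (i j : Fin 2) :
    Commute X (Lax l q κ ξ u v lam n i j) := by
  have h0 : Commute X (uop l q u n) := hX 0
  have h1 : Commute X (uopInv l q u n) := hX 1
  have h2 : Commute X (vop l v n) := hX 2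
  have h3 : Commute X (vopInv l v n) := hX 3
  unfold Lax
  rw [Matrix.smul_apply]
  apply Commute.smul_right
  have hs : ∀ (a : ℂ) (Y : Matrix (Idx l N) (Idx l N) ℂ), Commute X Y → Commute X (a • Y) :=
    fun a Y h => h.smul_right a
  fin_cases i <;> fin_cases j <;>
    simp only [Fin.zero_eta, Fin.mk_one, Matrix.of_apply, Matrix.cons_val_zero,
      Matrix.cons_val_one, Matrix.cons_val_fin_one, Fin.isValue, Matrix.cons_val']
  · exact hs _ _ (h0.mul_right ((hs _ _ h2).add_right (hs _ _ h3)))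
  · exact (hs _ _ h2).sub_right (hs _ _ h3)
  · exact (hs _ _ h3).sub_right (hs _ _ h2)
  · exact hs _ _ (h1.mul_right ((hs _ _ h2).add_right (hs _ _ h3)))

lemma Lax_comm (κ ξ u v : Fin N → ℂ) (lam mu : ℂ) (n m : Fin N) (h : n ≠ m) (i j k t : Fin 2) :
    Commute (Lax l q κ ξ u v lam n i j) (Lax l q κ ξ u v mu m k t) := by
  apply comm_Lax
  intro a
  apply Commute.symm
  apply comm_Lax
  intro b
  exact gen_comm u v m n h.symm a b

lemma prod_comm (κ ξ u v : Fin N → ℂ) (lam : ℂ) (X : Matrix (Idx l N) (Idx l N) ℂ)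
    (L : List (Fin N)) (hX : ∀ n ∈ L, ∀ i j, Commute X (Lax l q κ ξ u v lam n i j))
    (i j : Fin 2) : Commute X ((L.map (Lax l q κ ξ u v lam)).prod i j) := by
  induction L generalizing i j with
  | nil =>
    simp only [List.map_nil, List.prod_nil, Matrix.one_apply]
    split_ifs
    · exact Commute.one_right _
    · exact Commute.zero_right _
  | cons a L ih =>
    simp only [List.map_cons, List.prod_cons, Matrix.mul_apply]
    apply Commute.sum_right
    intro k _
    exact (hX a (by simp) _ _).mul_right (ih (fun n hn => hX n (by simp [hn])) _ _)

lemma Lax_rel (hl : 1 ≤ l) (hq : q ^ (2 * l + 1) = 1) (κ ξ u v : Fin N → ℂ) (n : Fin N)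
    (hκ : κ n ≠ 0) (hξ : ξ n ≠ 0) (hu : u n ≠ 0) (hv : v n ≠ 0) (lam mu : ℂ)
    (hlam : lam ≠ 0) (hmu : mu ≠ 0) :
    Rel q (lam / mu) (Lax l q κ ξ u v lam n) (Lax l q κ ξ u v mu n) := by
  have hs : (q ^ (l + 1)) ^ 2 = q := by
    rw [← pow_mul, show (l + 1) * 2 = (2 * l + 1) + 1 by ring, pow_succ, hq, one_mul]
  have hq0 : q ≠ 0 := by rintro rfl; simp at hq
  have key := rll (q ^ (l + 1)) (κ n) (lam / ξ n) (mu / ξ n) (κ n / Complex.I)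
    (pow_ne_zero _ hq0) hκ (div_ne_zero hlam hξ) (div_ne_zero hmu hξ)
    (uop l q u n) (uopInv l q u n) (vop l v n) (vopInv l v n)
    (VW v n hv) (WV v n hv) (UUi hq u n hu) (UiU hq u n hu)
    (by rw [hs]; exact VU hl hq u v n) (by rw [hs]; exact WU hl hq u v n)
    (by rw [hs]; exact VUi hl hq u v n) (by rw [hs]; exact WUi hl hq u v n)
  rw [hs, div_div_div_cancel_right₀ hξ] at key
  exact key

lemma prod_rel (hl : 1 ≤ l) (hq : q ^ (2 * l + 1) = 1) (κ ξ u v : Fin N → ℂ)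
    (hκ : ∀ n, κ n ≠ 0) (hξ : ∀ n, ξ n ≠ 0) (hu : ∀ n, u n ≠ 0) (hv : ∀ n, v n ≠ 0) (lam mu : ℂ)
    (hlam : lam ≠ 0) (hmu : mu ≠ 0) (L : List (Fin N)) (hL : L.Nodup) :
    Rel q (lam / mu) (L.map (Lax l q κ ξ u v lam)).prod (L.map (Lax l q κ ξ u v mu)).prod := by
  induction L with
  | nil => exact Rel.one _ _
  | cons a L ih =>
    rw [List.nodup_cons] at hL
    simp only [List.map_cons, List.prod_cons]
    refine (Lax_rel hl hq κ ξ u v a (hκ a) (hξ a) (hu a) (hv a) lam mu hlam hmu).mul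
      (ih hL.2) ?_ ?_
    · intro i j k m
      refine (prod_comm κ ξ u v lam _ L (fun n hn i j => ?_) i j).symm
      exact Lax_comm _ _ _ _ _ _ _ _ (fun h => hL.1 (by rw [h]; exact hn)) _ _ _ _
    · intro i j k m
      refine (prod_comm κ ξ u v mu _ L (fun n hn i j => ?_) i j).symm
      exact Lax_comm _ _ _ _ _ _ _ _ (fun h => hL.1 (by rw [h]; exact hn)) _ _ _ _

lemma Mon_eq (κ ξ u v : Fin N → ℂ) (lam : ℂ) :
    Mon l q κ ξ u v lam = ((List.finRange N).reverse.map (Lax l q κ ξ u v lam)).prod := by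
  unfold Mon
  rw [List.ofFn_eq_map, List.map_reverse]

lemma Lax_cont (κ ξ u v : Fin N → ℂ) (n : Fin N) (hξ : ξ n ≠ 0) (lam : ℂ) (hlam : lam ≠ 0) :
    ContinuousAt (fun x => Lax l q κ ξ u v x n) lam := by
  have h1 : ContinuousAt (fun x : ℂ => x / ξ n) lam := by fun_prop
  have h2 : ContinuousAt (fun x : ℂ => (x / ξ n)⁻¹) lam := h1.inv₀ (div_ne_zero hlam hξ)
  unfold Lax
  refine ContinuousAt.const_smul (c := κ n / Complex.I) ?_
  refine continuousAt_pi.2 fun i => continuousAt_pi.2 fun j => ?_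
  have hc : ∀ Y : Matrix (Idx l N) (Idx l N) ℂ, ContinuousAt (fun _ : ℂ => Y) lam :=
    fun Y => continuousAt_const
  fin_cases i <;> fin_cases j
  · exact hc _
  · exact (h1.smul (hc (vop l v n))).sub (h2.smul (hc (vopInv l v n)))
  · exact (h1.smul (hc (vopInv l v n))).sub (h2.smul (hc (vop l v n)))
  · exact hc _

lemma Top_cont (κ ξ u v : Fin N → ℂ) (hξ : ∀ n, ξ n ≠ 0) (lam : ℂ) (hlam : lam ≠ 0) :
    ContinuousAt (fun x => Top l q κ ξ u v x) lam := by
  have key : ∀ L : List (Fin N),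
      ContinuousAt (fun x => (L.map (Lax l q κ ξ u v x)).prod) lam := by
    intro L
    induction L with
    | nil => exact continuousAt_const
    | cons a L ih =>
      simp only [List.map_cons, List.prod_cons]
      exact (Lax_cont κ ξ u v a (hξ a) lam hlam).mul ih
  unfold SG.Top
  simp only [Mon_eq]
  have h := key (List.finRange N).reverse
  have e : ∀ i j, ContinuousAt
      (fun x => ((List.finRange N).reverse.map (Lax l q κ ξ u v x)).prod i j) lam :=
    fun i j => continuousAt_pi.1 (continuousAt_pi.1 h i) j
  exact (e 0 0).add (e 1 1)

lemma generic (hl : 1 ≤ l) (hq : q ^ (2 * l + 1) = 1) (κ ξ u v : Fin N → ℂ)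
    (hκ : ∀ n, κ n ≠ 0) (hξ : ∀ n, ξ n ≠ 0) (hu : ∀ n, u n ≠ 0) (hv : ∀ n, v n ≠ 0) (lam mu : ℂ)
    (hlam : lam ≠ 0) (hmu : mu ≠ 0) (h1 : (lam / mu) ^ 2 * q ^ 2 - 1 ≠ 0)
    (h2 : (lam / mu) ^ 2 - q ^ 2 ≠ 0) :
    Top l q κ ξ u v lam * Top l q κ ξ u v mu = Top l q κ ξ u v mu * Top l q κ ξ u v lam := by
  have hq0 : q ≠ 0 := by rintro rfl; simp at hq
  obtain ⟨S, hS⟩ := Rmat_inv q (lam / mu) hq0 (div_ne_zero hlam hmu) h1 h2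
  unfold SG.Top
  rw [Mon_eq, Mon_eq]
  exact (prod_rel hl hq κ ξ u v hκ hξ hu hv lam mu hlam hmu _
    (List.nodup_reverse.2 (List.nodup_finRange N))).trace S hS

end Ops

end SGProof

open SGProof in
/-- **Commutativity of transfer matrices**: `T(λ)·T(μ) = T(μ)·T(λ)`. -/
theorem transfer_matrices_commute (l N : ℕ) (hl : 1 ≤ l)
    (q : ℂ) (hq : IsPrimitiveRoot q (2*l+1))
    (κ ξ u v : Fin N → ℂ) (hκ : ∀ n, κ n ≠ 0) (hξ : ∀ n, ξ n ≠ 0)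
    (hu : ∀ n, u n ≠ 0) (hv : ∀ n, v n ≠ 0)
    (lam mu : ℂ) (hlam : lam ≠ 0) (hmu : mu ≠ 0) :
    Top l q κ ξ u v lam * Top l q κ ξ u v mu
      = Top l q κ ξ u v mu * Top l q κ ξ u v lam := by
  have hq1 := hq.pow_eq_one
  have hq0 : q ≠ 0 := by rintro rfl; simp at hq1
  have hc : ContinuousAt (fun x => Top l q κ ξ u v x) lam := Top_cont κ ξ u v hξ lam hlam
  have t1 := ((hc.mul (continuousAt_const (y := Top l q κ ξ u v mu))).tendsto).mono_left
    (nhdsWithin_le_nhds (s := {lam}ᶜ))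
  have t2 := (((continuousAt_const (y := Top l q κ ξ u v mu)).mul hc).tendsto).mono_left
    (nhdsWithin_le_nhds (s := {lam}ᶜ))
  refine tendsto_nhds_unique_of_eventuallyEq t1 t2 ?_
  have hfin : ({0, mu / q, -(mu / q), mu * q, -(mu * q)} : Set ℂ).Finite := by simp
  have hev : ∀ᶠ x in nhdsWithin lam {lam}ᶜ,
      x ∉ ({0, mu / q, -(mu / q), mu * q, -(mu * q)} : Set ℂ) := by
    have h := (hfin.subset (Set.diff_subset (t := {lam}))).isClosed.isOpen_compl.mem_nhds
      (show lam ∈ (({0, mu / q, -(mu / q), mu * q, -(mu * q)} : Set ℂ) \ {lam})ᶜ by simp)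
    filter_upwards [nhdsWithin_le_nhds h, self_mem_nhdsWithin] with x hx hx' hx''
    exact hx ⟨hx'', hx'⟩
  filter_upwards [hev] with x hx
  simp only [Set.mem_insert_iff, Set.mem_singleton_iff, not_or] at hx
  obtain ⟨x0, x1, x2, x3, x4⟩ := hx
  apply generic hl hq1 κ ξ u v hκ hξ hu hv x mu x0 hmu
  · intro h
    have : (x - mu / q) * (x - -(mu / q)) = 0 := by
      field_simp at h ⊢; linear_combination h
    rcases mul_eq_zero.1 this with h | h
    · exact x1 (sub_eq_zero.1 h)
    · exact x2 (sub_eq_zero.1 h)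
  · intro h
    have : (x - mu * q) * (x - -(mu * q)) = 0 := by
      field_simp at h ⊢; linear_combination h
    rcases mul_eq_zero.1 this with h | h
    · exact x3 (sub_eq_zero.1 h)
    · exact x4 (sub_eq_zero.1 h)
end
end
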